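/- Every group is covered by a maximal group: if G is a group on a closed interval I ⊆ [t_0, t_τ] (for parameters ε, m, δ and piecewise-linear trajectories), then there exist a set H ⊇ G and a closed interval I_H ⊇ I such that H is a maximal group on I_H. -/

import Mathlib

open Set

/-- The plane with the Euclidean metric. -/
abbrev Plane : Type := EuclideanSpace ℝ (Fin 2)

/-- `f` is a piecewise-linear trajectory with breakpoints `t 0, …, t τ`:
it is (the restriction of) an affine map on each interval `[t i, t (i+1)]`. -/
def IsPLTrajectory (τ : ℕ) (t : Fin (τ + 1) → ℝ) (f : ℝ → Plane) : Prop :=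
  ∀ i : Fin τ, ∃ g : ℝ →ᵃ[ℝ] Plane,
    ∀ s ∈ Icc (t i.castSucc) (t i.succ), f s = g s

/-- Entities `x` and `y` are directly connected at time `s`: their `ε`-discs overlap. -/
def DirectlyConnected {n : ℕ} (p : Fin n → ℝ → Plane) (ε s : ℝ) (x y : Fin n) : Prop :=
  dist (p x s) (p y s) ≤ 2 * ε

/-- Entities `x` and `y` are `ε`-connected at time `s`: there is a sequence
`x = x_0, …, x_k = y` of entities with consecutive ones directly connected at `s`. -/
def EpsConnected {n : ℕ} (p : Fin n → ℝ → Plane) (ε s : ℝ) : Fin n → Fin n → Prop :=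
  Relation.ReflTransGen (DirectlyConnected p ε s)

/-- A component at time `s` is a maximal set of pairwise `ε`-connected entities. -/
def IsComponent {n : ℕ} (p : Fin n → ℝ → Plane) (ε s : ℝ) (C : Set (Fin n)) : Prop :=
  (∀ x ∈ C, ∀ y ∈ C, EpsConnected p ε s x y) ∧
  (∀ D : Set (Fin n), C ⊆ D → (∀ x ∈ D, ∀ y ∈ D, EpsConnected p ε s x y) → D = C)
/-- `G` is a group on the interval `[a, b] ⊆ [t0, tτ]` for parameters `ε`, `m`, `δ`:
it has at least `m` entities, the interval has length at least `δ`, and at every time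
`s ∈ [a, b]` all of `G` lies in a single component. -/
def IsGroup {n : ℕ} (p : Fin n → ℝ → Plane) (ε : ℝ) (m : ℕ) (δ t0 tτ : ℝ)
    (G : Finset (Fin n)) (a b : ℝ) : Prop :=
  m ≤ G.card ∧ t0 ≤ a ∧ a ≤ b ∧ b ≤ tτ ∧ δ ≤ b - a ∧
  ∀ s ∈ Icc a b, ∃ C : Set (Fin n), IsComponent p ε s C ∧ ↑G ⊆ C

/-- `G` is a maximal group on `[a, b]`: it is a group on `[a, b]`, and the only group
`(H, [c, d])` covering `(G, [a, b])` (i.e. with `G ⊆ H` and `[a, b] ⊆ [c, d]`) is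
`(G, [a, b])` itself. -/
def IsMaximalGroup {n : ℕ} (p : Fin n → ℝ → Plane) (ε : ℝ) (m : ℕ) (δ t0 tτ : ℝ)
    (G : Finset (Fin n)) (a b : ℝ) : Prop :=
  IsGroup p ε m δ t0 tτ G a b ∧
  ∀ (H : Finset (Fin n)) (c d : ℝ), IsGroup p ε m δ t0 tτ H c d →
    G ⊆ H → c ≤ a → b ≤ d → H = G ∧ c = a ∧ d = b

theorem pl_continuousOn {τ : ℕ} {t : Fin (τ + 1) → ℝ} (ht : StrictMono t) {f : ℝ → Plane}
    (hf : IsPLTrajectory τ t f) : ContinuousOn f (Icc (t 0) (t (Fin.last τ))) := by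
  have key : ∀ k : Fin (τ + 1), ContinuousOn f (Icc (t 0) (t k)) := by
    intro k
    induction k using Fin.induction with
    | zero => simp
    | succ i ih =>
      obtain ⟨g, hg⟩ := hf i
      have h2 : ContinuousOn f (Icc (t i.castSucc) (t i.succ)) :=
        (g.continuous_of_finiteDimensional.continuousOn).congr hg
      have h3 := ih.union_of_isClosed h2 isClosed_Icc isClosed_Icc
      refine h3.mono ?_
      intro s hs
      rcases le_total s (t i.castSucc) with h | h
      · exact Or.inl ⟨hs.1, h⟩
      · exact Or.inr ⟨h, hs.2⟩
  exact key _

theorem eps_symm {n : ℕ} {p : Fin n → ℝ → Plane} {ε s : ℝ} {x y : Fin n}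
    (h : EpsConnected p ε s x y) : EpsConnected p ε s y x := by
  have hs : ∀ a b, DirectlyConnected p ε s a b → DirectlyConnected p ε s b a := by
    intro a b hab
    unfold DirectlyConnected at *
    rwa [dist_comm]
  unfold EpsConnected at *
  induction h with
  | refl => exact Relation.ReflTransGen.refl
  | tail _ h2 ih => exact Relation.ReflTransGen.head (hs _ _ h2) ih

theorem comp_iff {n : ℕ} {p : Fin n → ℝ → Plane} {ε s : ℝ} {G : Finset (Fin n)}
    (hG : G.Nonempty) :
    (∃ C : Set (Fin n), IsComponent p ε s C ∧ ↑G ⊆ C) ↔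
      ∀ x ∈ G, ∀ y ∈ G, EpsConnected p ε s x y := by
  constructor
  · rintro ⟨C, hC, hs⟩ x hx y hy
    exact hC.1 x (hs hx) y (hs hy)
  · intro h
    obtain ⟨x0, h0⟩ := hG
    refine ⟨{y | EpsConnected p ε s x0 y}, ⟨?_, ?_⟩, fun y hy => h x0 h0 y hy⟩
    · intro x hx y hy
      exact Relation.ReflTransGen.trans (eps_symm hx) hy
    · intro D hCD hD
      refine Subset.antisymm ?_ hCD
      intro y hy
      exact hD x0 (hCD Relation.ReflTransGen.refl) y hy

theorem closed_aux {n : ℕ} {p : Fin n → ℝ → Plane} {ε t0 t1 : ℝ}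
    (hp : ∀ x, ContinuousOn (p x) (Icc t0 t1)) (G : Finset (Fin n)) (A : Set ℝ)
    (hA : A ⊆ Icc t0 t1)
    (h : ∀ s ∈ A, ∀ x ∈ G, ∀ y ∈ G, EpsConnected p ε s x y) :
    ∀ s ∈ closure A, ∀ x ∈ G, ∀ y ∈ G, EpsConnected p ε s x y := by
  intro u hu
  have huI : u ∈ Icc t0 t1 := closure_minimal hA isClosed_Icc hu
  have hev : ∀ x y : Fin n, ∀ᶠ s in nhdsWithin u A,
      DirectlyConnected p ε s x y → DirectlyConnected p ε u x y := by
    intro x y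
    by_cases hd : DirectlyConnected p ε u x y
    · exact Filter.Eventually.of_forall fun _ _ => hd
    · have hc : Filter.Tendsto (fun s => dist (p x s) (p y s)) (nhdsWithin u A)
          (nhds (dist (p x u) (p y u))) :=
        (Filter.Tendsto.dist (hp x u huI) (hp y u huI)).mono_left (nhdsWithin_mono u hA)
      unfold DirectlyConnected at hd
      filter_upwards [hc.eventually (lt_mem_nhds (not_le.1 hd))] with s hs h1
      exact absurd h1 (not_le.2 hs)
  have hall : ∀ᶠ s in nhdsWithin u A, ∀ x y : Fin n,
      DirectlyConnected p ε s x y → DirectlyConnected p ε u x y := by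
    rw [Filter.eventually_all]
    intro x
    rw [Filter.eventually_all]
    exact hev x
  have : (nhdsWithin u A).NeBot := mem_closure_iff_nhdsWithin_neBot.1 hu
  obtain ⟨s, hs, hsA⟩ := (hall.and self_mem_nhdsWithin).exists
  intro x hx y hy
  exact Relation.ReflTransGen.mono hs _ _ (h s hsA x hx y hy)

/-- Every group is covered by a maximal group: if `G` is a group on `[a, b]`, then there
are a set `H ⊇ G` and an interval `[c, d] ⊇ [a, b]` such that `H` is a maximal group on
`[c, d]`. -/
theorem stmt_11 (n τ : ℕ) (t : Fin (τ + 1) → ℝ) (ht : StrictMono t)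
    (ε : ℝ) (hε : 0 ≤ ε) (m : ℕ) (hm : 1 ≤ m) (δ : ℝ) (hδ : 0 ≤ δ)
    (p : Fin n → ℝ → Plane) (hp : ∀ x, IsPLTrajectory τ t (p x))
    (G : Finset (Fin n)) (a b : ℝ)
    (hG : IsGroup p ε m δ (t 0) (t (Fin.last τ)) G a b) :
    ∃ (H : Finset (Fin n)) (c d : ℝ), G ⊆ H ∧ c ≤ a ∧ b ≤ d ∧
      IsMaximalGroup p ε m δ (t 0) (t (Fin.last τ)) H c d := by
  classical
  have hc := fun x => pl_continuousOn ht (hp x)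
  -- choose H of maximal cardinality
  let F : Finset (Finset (Fin n)) := Finset.univ.filter fun H =>
    G ⊆ H ∧ ∃ c d, c ≤ a ∧ b ≤ d ∧ IsGroup p ε m δ (t 0) (t (Fin.last τ)) H c d
  have hF : F.Nonempty := ⟨G, by
    simp only [F, Finset.mem_filter, Finset.mem_univ, true_and]
    exact ⟨Finset.Subset.refl _, a, b, le_rfl, le_rfl, hG⟩⟩
  obtain ⟨H, hHF, hmax⟩ := F.exists_max_image Finset.card hF
  simp only [F, Finset.mem_filter, Finset.mem_univ, true_and] at hHF hmax
  obtain ⟨hGH, c1, d1, hc1, hd1, hm1, h01, h11, h1t, hδ1, hcon⟩ := hHF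
  have hne : H.Nonempty := Finset.card_pos.1 (by omega)
  let A : Set ℝ := ⋃₀ {I | ∃ c d, I = Icc c d ∧ c ≤ c1 ∧ d1 ≤ d ∧
    IsGroup p ε m δ (t 0) (t (Fin.last τ)) H c d}
  have hA : ∀ s ∈ A, s ∈ Icc (t 0) (t (Fin.last τ)) ∧
      (∀ x ∈ H, ∀ y ∈ H, EpsConnected p ε s x y) ∧ Icc (min s c1) (max s d1) ⊆ A := by
    rintro s ⟨I, ⟨c, d, rfl, hcc, hdd, hg⟩, hs⟩
    refine ⟨⟨hg.2.1.trans hs.1, hs.2.trans hg.2.2.2.1⟩,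
      (comp_iff hne).1 (hg.2.2.2.2.2 s hs), fun r hr => ⟨_, ⟨c, d, rfl, hcc, hdd, hg⟩, ?_⟩⟩
    exact ⟨(le_min hs.1 hcc).trans hr.1, hr.2.trans (max_le hs.2 hdd)⟩
  have hg1 : IsGroup p ε m δ (t 0) (t (Fin.last τ)) H c1 d1 :=
    ⟨hm1, h01, h11, h1t, hδ1, hcon⟩
  have hA1 : c1 ∈ A := ⟨_, ⟨c1, d1, rfl, le_rfl, le_rfl, hg1⟩, le_rfl, h11⟩
  have hA2 : d1 ∈ A := ⟨_, ⟨c1, d1, rfl, le_rfl, le_rfl, hg1⟩, h11, le_rfl⟩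
  have hbb : BddBelow A := ⟨t 0, fun s hs => (hA s hs).1.1⟩
  have hba : BddAbove A := ⟨t (Fin.last τ), fun s hs => (hA s hs).1.2⟩
  have hcl := closed_aux (ε := ε) hc H A (fun s hs => (hA s hs).1) (fun s hs => (hA s hs).2.1)
  have hAI : closure A ⊆ Icc (t 0) (t (Fin.last τ)) :=
    closure_minimal (fun s hs => (hA s hs).1) isClosed_Icc
  have hcm : sInf A ∈ closure A := csInf_mem_closure ⟨_, hA1⟩ hbb
  have hdm : sSup A ∈ closure A := csSup_mem_closure ⟨_, hA1⟩ hba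
  have hcc1 : sInf A ≤ c1 := csInf_le hbb hA1
  have hdd1 : d1 ≤ sSup A := le_csSup hba hA2
  have hsub : Icc (sInf A) (sSup A) ⊆ closure A := by
    intro s hs
    rcases hs.1.eq_or_lt with h | h
    · exact h ▸ hcm
    rcases hs.2.eq_or_lt with h' | h'
    · exact h' ▸ hdm
    apply subset_closure
    obtain ⟨r, hr, hrs⟩ := exists_lt_of_csInf_lt ⟨_, hA1⟩ h
    obtain ⟨q, hq, hqs⟩ := exists_lt_of_lt_csSup ⟨_, hA1⟩ h'
    rcases le_total s d1 with h2 | h2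
    · exact (hA r hr).2.2 ⟨(min_le_left _ _).trans hrs.le, h2.trans (le_max_right _ _)⟩
    · exact (hA q hq).2.2 ⟨(min_le_right _ _).trans (h11.trans h2),
        hqs.le.trans (le_max_left _ _)⟩
  have hca : sInf A ≤ a := hcc1.trans hc1
  have hbd : b ≤ sSup A := hd1.trans hdd1
  refine ⟨H, sInf A, sSup A, hGH, hca, hbd,
    ⟨hm1, (hAI hcm).1, by linarith, (hAI hdm).2, by linarith, fun s hs =>
      (comp_iff hne).2 (hcl s (hsub hs))⟩, ?_⟩
  intro H' c d hg hHH hcc hdd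
  have hle := hmax H' ⟨hGH.trans hHH, c, d, hcc.trans hca, hbd.trans hdd, hg⟩
  have heq : H' = H := (Finset.eq_of_subset_of_card_le hHH hle).symm
  subst heq
  have hcd := hg.2.2.1
  refine ⟨rfl, le_antisymm hcc (csInf_le hbb ?_), le_antisymm (le_csSup hba ?_) hdd⟩
  · exact ⟨_, ⟨c, d, rfl, hcc.trans hcc1, hdd1.trans hdd, hg⟩, le_rfl, hcd⟩
  · exact ⟨_, ⟨c, d, rfl, hcc.trans hcc1, hdd1.trans hdd, hg⟩, hcd, le_rfl⟩
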